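/- arXiv:0903.3862 — 4 statements merged into one kernel-verified Lean document; each statement's English description precedes it below -/
import Mathlib

section
/- Let N be a positive integer, and for each positive divisor t of N let Θ_t be a set of φ(gcd(t,N/t)) pairs (u,v) of integers with gcd(u,t)=1, uv ≡ 1 mod t, whose first entries u are pairwise incongruent modulo gcd(t,N/t). Then the set of matrices ∪_{t|N} 𝔐_{Θ_t} is a complete set of representatives for the right cosets of Γ₀(N) in SL₂(ℤ): every A ∈ SL₂(ℤ) lies in Γ₀(N)·B for exactly one matrix B in this set. -/
open scoped MatrixGroups
open Complex

/-- The Weierstrass ℘-function of the lattice `L_τ = ℤ + ℤτ`. -/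
noncomputable def wp (τ z : ℂ) : ℂ :=
  1 / z ^ 2 + ∑' p : {p : ℤ × ℤ // p ≠ 0},
    (1 / (z - ((p.1.1 : ℂ) + (p.1.2 : ℂ) * τ)) ^ 2 - 1 / ((p.1.1 : ℂ) + (p.1.2 : ℂ) * τ) ^ 2)

/-- The function `W_𝔞` for the triple `𝔞 = [a₁,a₂,a₃]`. -/
noncomputable def Wfun (N : ℕ) (a₁ a₂ a₃ : ℤ) (τ : ℂ) : ℂ :=
  (wp τ ((a₁ : ℂ) / N) - wp τ ((a₃ : ℂ) / N)) / (wp τ ((a₂ : ℂ) / N) - wp τ ((a₃ : ℂ) / N))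

/-- Möbius action of an integral 2×2 matrix on ℂ. -/
noncomputable def moebius (A : Matrix (Fin 2) (Fin 2) ℤ) (τ : ℂ) : ℂ :=
  ((A 0 0 : ℂ) * τ + (A 0 1 : ℂ)) / ((A 1 0 : ℂ) * τ + (A 1 1 : ℂ))

/-- `𝔖_N = (ℤ/Nℤ)ˣ/{±1}`. -/
abbrev SNgroup (N : ℕ) := (ZMod N)ˣ ⧸ (Subgroup.closure ({-1} : Set (ZMod N)ˣ))

/-- The triple `𝔞 = [a₁,a₂,a₃]` is in `𝔈`. -/
def memE (N : ℕ) (a : ℤ × ℤ × ℤ) : Prop :=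
  0 < a.1 ∧ 0 < a.2.1 ∧ 0 < a.2.2 ∧ 2 * a.1 ≤ (N : ℤ) ∧ 2 * a.2.1 ≤ (N : ℤ) ∧
    2 * a.2.2 ≤ (N : ℤ) ∧ a.1 ≠ a.2.1 ∧ a.1 ≠ a.2.2 ∧ a.2.1 ≠ a.2.2

def memE1 (N : ℕ) (a : ℤ × ℤ × ℤ) : Prop :=
  memE N a ∧ IsCoprime (a.1 * a.2.1 * a.2.2) (N : ℤ)

def memE2 (N : ℕ) (a : ℤ × ℤ × ℤ) : Prop :=
  memE1 N a ∧ IsCoprime (a.1 - a.2.2) (N : ℤ) ∧ IsCoprime (a.1 + a.2.2) (N : ℤ) ∧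
    IsCoprime (a.2.1 - a.2.2) (N : ℤ) ∧ IsCoprime (a.2.1 + a.2.2) (N : ℤ)

/-- `M` is a lift to `Γ₀(N)` of `diag(λ⁻¹, λ)` for the class `s = λ ∈ 𝔖_N`. -/
def IsDiagLift (N : ℕ) (M : SL(2, ℤ)) (s : SNgroup N) : Prop :=
  ∃ u : (ZMod N)ˣ, (QuotientGroup.mk u : SNgroup N) = s ∧
    ((M 0 0 : ℤ) : ZMod N) = ((u⁻¹ : (ZMod N)ˣ) : ZMod N) ∧
    ((M 0 1 : ℤ) : ZMod N) = 0 ∧ ((M 1 0 : ℤ) : ZMod N) = 0 ∧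
    ((M 1 1 : ℤ) : ZMod N) = (u : ZMod N)

/-- The function `T_{𝔄,F}`. -/
noncomputable def Tfun (N : ℕ) {n : ℕ} (A : Fin n → ℤ × ℤ × ℤ)
    (F : MvPolynomial (Fin n) ℤ) (M : SNgroup N → SL(2, ℤ)) (τ : ℂ) : ℂ :=
  ∑ᶠ s : SNgroup N, MvPolynomial.aeval
    (fun i => Wfun N (A i).1 (A i).2.1 (A i).2.2 (moebius ((M s : SL(2, ℤ)) : Matrix (Fin 2) (Fin 2) ℤ) τ)) F

/-- The matrix `B(t,u,v,k)`. -/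
def Bmat (t : ℕ) (u v k : ℤ) : Matrix (Fin 2) (Fin 2) ℤ :=
  !![u, (u * v - 1) / (t : ℤ) + u * k; (t : ℤ), v + (t : ℤ) * k]

/-- `{a}` : the representative of `±a mod N` in `(0, N/2]` (paper's `{·}`). -/
def red (N : ℕ) (a : ℤ) : ℤ :=
  if 2 * (a % (N : ℤ)) ≤ (N : ℤ) then a % (N : ℤ) else (N : ℤ) - a % (N : ℤ)

/-- `μ(a) ∈ {±1}` with `a ≡ μ(a){a} mod N`. -/
def muSign (N : ℕ) (a : ℤ) : ℤ :=
  if 2 * (a % (N : ℤ)) ≤ (N : ℤ) then 1 else -1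

/-- `φ_s(τ) = (2πi)⁻²℘(s/N; L_τ) − 1/12`. -/
noncomputable def phiFun (N : ℕ) (s : ℤ) (τ : ℂ) : ℂ :=
  (1 / (2 * (Real.pi : ℂ) * Complex.I) ^ 2) * wp τ ((s : ℂ) / N) - 1 / 12

/-- `f[A]₂` : weight-2 slash of `φ_s`. -/
noncomputable def phiSlash (N : ℕ) (s : ℤ) (A : Matrix (Fin 2) (Fin 2) ℤ) (τ : ℂ) : ℂ :=
  phiFun N s (moebius A τ) * ((A 1 0 : ℂ) * τ + (A 1 1 : ℂ)) ^ (-2 : ℤ)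

/-- `q = e^{2πiτ/N}`. -/
noncomputable def qq (N : ℕ) (τ : ℂ) : ℂ :=
  Complex.exp (2 * (Real.pi : ℂ) * Complex.I * τ / N)

/-- `ζ = e^{2πi/N}`. -/
noncomputable def zetaN (N : ℕ) : ℂ :=
  Complex.exp (2 * (Real.pi : ℂ) * Complex.I / N)

/-- `θ_{a,b} = ζ^a(1−ζ^{b−a})(1−ζ^{b+a})/((1−ζ^a)²(1−ζ^b)²)`. -/
noncomputable def theta (ζ : ℂ) (a b : ℤ) : ℂ :=
  ζ ^ a * (1 - ζ ^ (b - a)) * (1 - ζ ^ (b + a)) / ((1 - ζ ^ a) ^ 2 * (1 - ζ ^ b) ^ 2)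

/-- `B(t,u,v,k)` has determinant one. -/
theorem Bmat_det {t : ℕ} (u v k : ℤ) (huv : u * v ≡ 1 [ZMOD (t : ℤ)]) :
    (Bmat t u v k).det = 1 := by
  have h : (u * v - 1) / (t : ℤ) * t = u * v - 1 := Int.ediv_mul_cancel huv.symm.dvd
  rw [Bmat, Matrix.det_fin_two_of]
  linear_combination -h

/-- Two elements of `SL₂(ℤ)` lie in the same right coset of `Γ₀(N)` iff their bottom rows are
proportional modulo `N`. -/
theorem exists_Gamma0_mul_iff (N : ℕ) (A : SL(2, ℤ)) (B : Matrix (Fin 2) (Fin 2) ℤ)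
    (hB : B.det = 1) :
    (∃ γ : SL(2, ℤ), γ ∈ CongruenceSubgroup.Gamma0 N ∧
        (A : Matrix (Fin 2) (Fin 2) ℤ) = (γ : Matrix (Fin 2) (Fin 2) ℤ) * B) ↔
      (N : ℤ) ∣ A 1 0 * B 1 1 - A 1 1 * B 1 0 := by
  obtain ⟨C, rfl⟩ : ∃ C : SL(2, ℤ), (C : Matrix (Fin 2) (Fin 2) ℤ) = B := ⟨⟨B, hB⟩, rfl⟩
  have key : ∀ γ : SL(2, ℤ), A = γ * C → γ 1 0 = A 1 0 * C 1 1 - A 1 1 * C 1 0 := by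
    intro γ h
    rw [Matrix.det_fin_two] at hB
    rw [h]
    simp only [Matrix.SpecialLinearGroup.coe_mul, Matrix.mul_apply, Fin.sum_univ_two]
    linear_combination -(γ 1 0) * hB
  constructor
  · rintro ⟨γ, hγ, h⟩
    rw [CongruenceSubgroup.Gamma0_mem, ZMod.intCast_zmod_eq_zero_iff_dvd] at hγ
    rwa [← key γ (Subtype.ext h)]
  · intro h
    have hA : A = A * C⁻¹ * C := by group
    refine ⟨A * C⁻¹, ?_, congrArg Subtype.val hA⟩
    rwa [CongruenceSubgroup.Gamma0_mem, ZMod.intCast_zmod_eq_zero_iff_dvd, key _ hA]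

/-- A set of `φ(g)` pairwise incongruent units modulo `g` represents every unit. -/
theorem exists_modEq_of_card_eq_totient {ι : Type*} (g : ℕ) (hg : 0 < g) (S : Finset ι)
    (f : ι → ℤ) (hcard : S.card = g.totient) (hunit : ∀ p ∈ S, IsCoprime (f p) (g : ℤ))
    (hinj : ∀ p ∈ S, ∀ q ∈ S, f p ≡ f q [ZMOD (g : ℤ)] → p = q)
    (w : ℤ) (hw : IsCoprime w (g : ℤ)) : ∃ p ∈ S, f p ≡ w [ZMOD (g : ℤ)] := by
  have : NeZero g := ⟨hg.ne'⟩
  have hU : ∀ a : ℤ, IsCoprime a (g : ℤ) → IsUnit (a : ZMod g) := fun a ha =>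
    (ZMod.coe_int_isUnit_iff_isCoprime a g).2 ha.symm
  let F : S → (ZMod g)ˣ := fun p => (hU (f p) (hunit p p.2)).unit
  have hF : Function.Injective F := by
    intro p q h
    have h' : ((f p : ℤ) : ZMod g) = (f q : ℤ) := congrArg Units.val h
    exact Subtype.ext (hinj p p.2 q q.2 ((ZMod.intCast_eq_intCast_iff _ _ _).1 h'))
  have hbij : Function.Bijective F := (Fintype.bijective_iff_injective_and_card F).2
    ⟨hF, by rw [Fintype.card_coe, hcard, ZMod.card_units_eq_totient]⟩
  obtain ⟨p, hp⟩ := hbij.2 (hU w hw).unit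
  exact ⟨p, p.2, (ZMod.intCast_eq_intCast_iff _ _ _).1 (congrArg Units.val hp)⟩

/-- The divisor `t` of a representative of the coset with bottom row `(c, d)` is `gcd(c, N)`. -/
theorem eq_gcd_of_dvd_sub {N t : ℕ} (ht : t ∣ N) {c d d' : ℤ} (hcd : IsCoprime c d)
    (hd' : IsCoprime d' (t : ℤ)) (h : (N : ℤ) ∣ c * d' - d * t) : t = Int.gcd c N := by
  have htN : (t : ℤ) ∣ N := Int.natCast_dvd_natCast.2 ht
  apply Nat.dvd_antisymm
  · refine Int.natCast_dvd_natCast.1 (Int.dvd_coe_gcd ?_ htN)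
    refine hd'.symm.dvd_of_dvd_mul_right ?_
    exact (dvd_sub_left (Dvd.intro_left _ rfl)).1 (htN.trans h)
  · have hc := Int.gcd_dvd_left c N
    refine Int.natCast_dvd_natCast.1 ((hcd.of_isCoprime_of_dvd_left hc).dvd_of_dvd_mul_left ?_)
    exact (dvd_sub_right (hc.mul_right d')).1 ((Int.gcd_dvd_right c N).trans h)

/-- If `t * x ≡ 0` modulo `m` then `x ≡ 0` modulo `m / gcd(t, m)`. -/
theorem div_gcd_dvd_of_dvd_mul {t m : ℕ} (hm : 0 < m) {x : ℤ} (h : (m : ℤ) ∣ t * x) :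
    ((m / Nat.gcd t m : ℕ) : ℤ) ∣ x := by
  have hg : 0 < Nat.gcd t m := Nat.gcd_pos_of_pos_right _ hm
  obtain ⟨a, ha⟩ := Nat.gcd_dvd_left t m
  obtain ⟨b, hb⟩ := Nat.gcd_dvd_right t m
  have hcop : Nat.Coprime (m / Nat.gcd t m) (t / Nat.gcd t m) :=
    (Nat.coprime_div_gcd_div_gcd hg).symm
  have ha' : t / Nat.gcd t m = a := Nat.div_eq_of_eq_mul_right hg ha
  have hb' : m / Nat.gcd t m = b := Nat.div_eq_of_eq_mul_right hg hb
  rw [ha', hb'] at hcop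
  rw [hb']
  have hg' : ((Nat.gcd t m : ℕ) : ℤ) ≠ 0 := by exact_mod_cast hg.ne'
  have haz : (t : ℤ) = (Nat.gcd t m : ℕ) * a := by exact_mod_cast ha
  have hbz : (m : ℤ) = (Nat.gcd t m : ℕ) * b := by exact_mod_cast hb
  rw [haz, hbz, mul_assoc] at h
  exact (Nat.isCoprime_iff_coprime.2 hcop).dvd_of_dvd_mul_left
    (Int.dvd_of_mul_dvd_mul_left hg' h)

/-- `N / gcd(t², N) = m / gcd(t, m)` for `N = t * m`. -/
theorem mul_div_gcd_sq {t m : ℕ} (ht : 0 < t) :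
    t * m / Nat.gcd (t ^ 2) (t * m) = m / Nat.gcd t m := by
  rw [sq, Nat.gcd_mul_left, Nat.mul_div_mul_left _ _ ht]

/-- Inverses modulo `t` of integers congruent modulo a divisor `g` of `t` are congruent
modulo `g`. -/
theorem modEq_of_mul_modEq {g t : ℤ} (hgt : g ∣ t) {u v u' v' : ℤ}
    (huv : u * v ≡ 1 [ZMOD t]) (huv' : u' * v' ≡ 1 [ZMOD t]) (h : v ≡ v' [ZMOD g]) :
    u ≡ u' [ZMOD g] := by
  have h1 := huv.of_dvd hgt
  have h2 := huv'.of_dvd hgt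
  calc u = u * 1 := (mul_one u).symm
    _ ≡ u * (u' * v') [ZMOD g] := h2.symm.mul_left u
    _ ≡ u * (u' * v) [ZMOD g] := (h.symm.mul_left u').mul_left u
    _ = u' * (u * v) := by ring
    _ ≡ u' * 1 [ZMOD g] := h1.mul_left u'
    _ = u' := mul_one u'

/-- The congruence `c (v + t k) ≡ d` modulo `m` is solvable in `0 ≤ k < m / gcd(t, m)` as soon
as it holds modulo `gcd(t, m)`. -/
theorem exists_shift {t m : ℕ} (hm : 0 < m) {c d v : ℤ} (hc : IsCoprime c (m : ℤ))
    (h : ((Nat.gcd t m : ℕ) : ℤ) ∣ d - c * v) :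
    ∃ k : ℤ, 0 ≤ k ∧ k < ((m / Nat.gcd t m : ℕ) : ℤ) ∧ (m : ℤ) ∣ c * (v + t * k) - d := by
  obtain ⟨x, y, hxy⟩ := hc
  obtain ⟨s, hs⟩ := h
  have hg : 0 < Nat.gcd t m := Nat.gcd_pos_of_pos_right _ hm
  obtain ⟨a, ha⟩ := Nat.gcd_dvd_left t m
  obtain ⟨b, hb⟩ := Nat.gcd_dvd_right t m
  have hbez := Nat.gcd_eq_gcd_ab t m
  have hb' : m / Nat.gcd t m = b := Nat.div_eq_of_eq_mul_right hg hb
  have haz : (t : ℤ) = (Nat.gcd t m : ℕ) * a := by exact_mod_cast ha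
  have hbz : (m : ℤ) = (Nat.gcd t m : ℕ) * b := by exact_mod_cast hb
  have hbpos : (0 : ℤ) < b := by
    have : 0 < b := Nat.pos_of_ne_zero (by rintro rfl; simp at hb; omega)
    exact_mod_cast this
  rw [hb']
  set k₀ := x * Nat.gcdA t m * s
  refine ⟨k₀ % b, Int.emod_nonneg _ hbpos.ne', Int.emod_lt_of_pos _ hbpos, ?_⟩
  have hk : k₀ % b = k₀ - b * (k₀ / b) := by rw [Int.emod_def]
  have htb : (t : ℤ) * b = m * a := by linear_combination (b : ℤ) * haz - (a : ℤ) * hbz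
  rw [hk]
  refine ⟨-(y * t * Nat.gcdA t m * s) - Nat.gcdB t m * s - c * a * (k₀ / b), ?_⟩
  have hk₀ : c * k₀ = (1 - y * m) * Nat.gcdA t m * s := by
    simp only [k₀]
    linear_combination Nat.gcdA t m * s * hxy
  linear_combination (t : ℤ) * hk₀ - c * (k₀ / b) * htb - hs - s * hbez

/-- `∪_{t|N} 𝔐_{Θ_t}` is a complete set of representatives of the right cosets
of `Γ₀(N)` in `SL₂(ℤ)`. -/
theorem stmt1 (N : ℕ) (hN : 0 < N) (Θ : ℕ → Finset (ℤ × ℤ))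
    (hcard : ∀ t ∈ N.divisors, (Θ t).card = Nat.totient (Nat.gcd t (N / t)))
    (hmem : ∀ t ∈ N.divisors, ∀ p ∈ Θ t,
        IsCoprime p.1 (t : ℤ) ∧ p.1 * p.2 ≡ 1 [ZMOD (t : ℤ)])
    (hinc : ∀ t ∈ N.divisors, ∀ p ∈ Θ t, ∀ q ∈ Θ t,
        p.1 ≡ q.1 [ZMOD ((Nat.gcd t (N / t) : ℕ) : ℤ)] → p = q) :
    ∀ A : SL(2, ℤ), ∃! B : Matrix (Fin 2) (Fin 2) ℤ,
      (∃ t ∈ N.divisors, ∃ p ∈ Θ t, ∃ k : ℤ,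
          0 ≤ k ∧ k < ((N / Nat.gcd (t ^ 2) N : ℕ) : ℤ) ∧ B = Bmat t p.1 p.2 k) ∧
      ∃ γ : SL(2, ℤ), γ ∈ CongruenceSubgroup.Gamma0 N ∧
        (A : Matrix (Fin 2) (Fin 2) ℤ) = (γ : Matrix (Fin 2) (Fin 2) ℤ) * B := by
  intro A
  have hcd : IsCoprime (A 1 0) (A 1 1) := by
    have hdet := A.det_coe
    rw [Matrix.det_fin_two] at hdet
    exact ⟨-A 0 1, A 0 0, by linear_combination hdet⟩
  have hcoset : ∀ t ∈ N.divisors, ∀ p ∈ Θ t, ∀ k : ℤ,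
      ((∃ γ : SL(2, ℤ), γ ∈ CongruenceSubgroup.Gamma0 N ∧
        (A : Matrix (Fin 2) (Fin 2) ℤ) = (γ : Matrix (Fin 2) (Fin 2) ℤ) * Bmat t p.1 p.2 k) ↔
      (N : ℤ) ∣ A 1 0 * (p.2 + t * k) - A 1 1 * t) := fun t ht p hp k => by
    rw [exists_Gamma0_mul_iff N A _ (Bmat_det _ _ k (hmem t ht p hp).2)]
    simp [Bmat]
  set c := A 1 0
  set d := A 1 1
  obtain ⟨t, htdef⟩ : ∃ t, t = Int.gcd c N := ⟨_, rfl⟩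
  have htN : t ∣ N := by
    rw [htdef]
    exact Int.natCast_dvd_natCast.1 (Int.gcd_dvd_right c N)
  have htpos : 0 < t := Nat.pos_of_dvd_of_pos htN hN
  have htz : (t : ℤ) ≠ 0 := by exact_mod_cast htpos.ne'
  have htmem : t ∈ N.divisors := Nat.mem_divisors.2 ⟨htN, hN.ne'⟩
  obtain ⟨m, hm⟩ := htN
  have hNt : N / t = m := Nat.div_eq_of_eq_mul_right htpos hm
  have hmpos : 0 < m := Nat.pos_of_ne_zero (by rintro rfl; omega)
  have hNz : (N : ℤ) = t * m := by exact_mod_cast hm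
  have hrange : N / Nat.gcd (t ^ 2) N = m / Nat.gcd t m := by rw [hm, mul_div_gcd_sq htpos]
  have hcard' := hcard t htmem
  have hinc' := hinc t htmem
  have hmem' := hmem t htmem
  rw [hNt] at hcard' hinc'
  obtain ⟨c₁, hc₁⟩ : (t : ℤ) ∣ c := htdef ▸ Int.gcd_dvd_left c N
  have hc₁m : IsCoprime c₁ (m : ℤ) := by
    have hbez := Int.gcd_eq_gcd_ab c N
    rw [← htdef] at hbez
    refine ⟨Int.gcdA c N, Int.gcdB c N, mul_left_cancel₀ htz ?_⟩
    linear_combination -hbez - Int.gcdA c N * hc₁ - Int.gcdB c N * hNz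
  have hdt : IsCoprime d (t : ℤ) := (hcd.of_isCoprime_of_dvd_left ⟨c₁, hc₁⟩).symm
  have hgt : ((Nat.gcd t m : ℕ) : ℤ) ∣ t := Int.natCast_dvd_natCast.2 (Nat.gcd_dvd_left t m)
  have hgm : ((Nat.gcd t m : ℕ) : ℤ) ∣ m := Int.natCast_dvd_natCast.2 (Nat.gcd_dvd_right t m)
  have hdvd : ∀ p : ℤ × ℤ, ∀ k : ℤ,
      (N : ℤ) ∣ c * (p.2 + t * k) - d * t ↔ (m : ℤ) ∣ c₁ * (p.2 + t * k) - d := by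
    intro p k
    have h : c * (p.2 + t * k) - d * t = t * (c₁ * (p.2 + t * k) - d) := by rw [hc₁]; ring
    rw [h, hNz, mul_dvd_mul_iff_left htz]
  apply existsUnique_of_exists_of_unique
  · obtain ⟨e, f, hef⟩ := hdt
    have hw : IsCoprime (c₁ * e) ((Nat.gcd t m : ℕ) : ℤ) :=
      (hc₁m.of_isCoprime_of_dvd_right hgm).mul_left
        (IsCoprime.of_isCoprime_of_dvd_right ⟨d, f, by linear_combination hef⟩ hgt)
    obtain ⟨p, hp, hpw⟩ := exists_modEq_of_card_eq_totient (Nat.gcd t m)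
      (Nat.gcd_pos_of_pos_left _ htpos) (Θ t) Prod.fst hcard'
      (fun p hp => (hmem' p hp).1.of_isCoprime_of_dvd_right hgt) hinc' _ hw
    have hv : ((Nat.gcd t m : ℕ) : ℤ) ∣ d - c₁ * p.2 := by
      obtain ⟨r, hr⟩ := hpw.dvd
      obtain ⟨s, hs⟩ := (hmem' p hp).2.dvd
      obtain ⟨a, ha⟩ := hgt
      refine ⟨a * s * d - r * p.2 * d - a * f * c₁ * p.2, ?_⟩
      linear_combination d * hs - p.2 * d * hr + c₁ * p.2 * hef + (s * d - f * c₁ * p.2) * ha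
    obtain ⟨k, hk0, hk1, hk⟩ := exists_shift hmpos hc₁m hv
    exact ⟨Bmat t p.1 p.2 k, ⟨t, htmem, p, hp, k, hk0, by rwa [hrange], rfl⟩,
      (hcoset t htmem p hp k).2 ((hdvd p k).2 hk)⟩
  · have hred : ∀ B : Matrix (Fin 2) (Fin 2) ℤ,
        (∃ t ∈ N.divisors, ∃ p ∈ Θ t, ∃ k : ℤ,
          0 ≤ k ∧ k < ((N / Nat.gcd (t ^ 2) N : ℕ) : ℤ) ∧ B = Bmat t p.1 p.2 k) ∧
        (∃ γ : SL(2, ℤ), γ ∈ CongruenceSubgroup.Gamma0 N ∧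
          (A : Matrix (Fin 2) (Fin 2) ℤ) = (γ : Matrix (Fin 2) (Fin 2) ℤ) * B) →
        ∃ p ∈ Θ t, ∃ k : ℤ, 0 ≤ k ∧ k < ((m / Nat.gcd t m : ℕ) : ℤ) ∧
          B = Bmat t p.1 p.2 k ∧ (m : ℤ) ∣ c₁ * (p.2 + t * k) - d := by
      rintro B ⟨⟨t', ht', p, hp, k, hk0, hk1, rfl⟩, hγ⟩
      rw [hcoset t' ht' p hp k] at hγ
      have hcop : IsCoprime (p.2 + t' * k) (t' : ℤ) := by
        obtain ⟨s, hs⟩ := (hmem t' ht' p hp).2.dvd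
        exact ⟨p.1, s - p.1 * k, by linear_combination -hs⟩
      obtain rfl : t' = t :=
        (eq_gcd_of_dvd_sub (Nat.dvd_of_mem_divisors ht') hcd hcop hγ).trans htdef.symm
      exact ⟨p, hp, k, hk0, hrange ▸ hk1, rfl, (hdvd p k).1 hγ⟩
    intro B B' hB hB'
    obtain ⟨p, hp, k, hk0, hk1, rfl, hk⟩ := hred B hB
    obtain ⟨q, hq, l, hl0, hl1, rfl, hl⟩ := hred B' hB'
    have hdiff : (m : ℤ) ∣ (q.2 + t * l) - (p.2 + t * k) := by
      refine hc₁m.symm.dvd_of_dvd_mul_left ?_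
      have h := dvd_sub hl hk
      rwa [sub_sub_sub_cancel_right, ← mul_sub] at h
    have hpq : p.2 ≡ q.2 [ZMOD ((Nat.gcd t m : ℕ) : ℤ)] := by
      rw [Int.modEq_iff_dvd]
      rw [show q.2 - p.2 = (q.2 + t * l) - (p.2 + t * k) - t * (l - k) by ring]
      exact dvd_sub (hgm.trans hdiff) (hgt.mul_right (l - k))
    obtain rfl := hinc' p hp q hq (modEq_of_mul_modEq hgt (hmem' p hp).2 (hmem' q hq).2 hpq)
    have hlk : ((m / Nat.gcd t m : ℕ) : ℤ) ∣ l - k := by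
      refine div_gcd_dvd_of_dvd_mul hmpos ?_
      rwa [show t * (l - k) = (p.2 + t * l) - (p.2 + t * k) by ring]
    have : l - k = 0 := Int.eq_zero_of_abs_lt_dvd hlk (abs_lt.2 ⟨by linarith, by linarith⟩)
    rw [show l = k by linarith]
end

section
/- For every positive integer N, the sum over positive divisors t of N of (N/gcd(t²,N))·φ(gcd(t,N/t)) equals the index [SL₂(ℤ) : Γ₀(N)], which equals N·∏_{p|N}(1 + 1/p), the product being over the prime divisors p of N. -/
open scoped MatrixGroups
open Complex

theorem Subgroup.index_eq_ncard_range {G X : Type*} [Group G] (H : Subgroup G) (f : G → X)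
    (hf : ∀ g h, f g = f h ↔ g⁻¹ * h ∈ H) : H.index = (Set.range f).ncard := by
  let F : G ⧸ H → X := Quotient.lift f fun g h hgh =>
    (hf g h).2 (QuotientGroup.leftRel_apply.1 hgh)
  have hF : Function.Injective F := by
    rintro ⟨g⟩ ⟨h⟩ hgh
    exact QuotientGroup.eq.2 ((hf g h).1 hgh)
  have hrange : Set.range F = Set.range f := Set.range_quot_lift _
  rw [Subgroup.index, ← hrange, ← Nat.card_coe_set_eq, Nat.card_range_of_injective hF]

namespace CongruenceSubgroup

theorem mem_Gamma0_iff_dvd {N : ℕ} {A : SL(2, ℤ)} : A ∈ Gamma0 N ↔ (N : ℤ) ∣ A 1 0 := by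
  rw [Gamma0_mem, ZMod.intCast_zmod_eq_zero_iff_dvd]

/-- The element of the projective line over `ZMod p` with homogeneous coordinates `c / N` and `a`,
where `a` and `c` form the first column of `g`; the point at infinity is `none`. -/
def columnRatio (N p : ℕ) [Fact p.Prime] (g : Gamma0 N) : Option (ZMod p) :=
  if ((g.1 0 0 : ℤ) : ZMod p) = 0 then none
  else some (((g.1 1 0 / N : ℤ) : ZMod p) / ((g.1 0 0 : ℤ) : ZMod p))

theorem columnRatio_eq_iff {N p : ℕ} [Fact p.Prime] (hN : 0 < N) (g h : Gamma0 N) :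
    columnRatio N p g = columnRatio N p h ↔ g⁻¹ * h ∈ (Gamma0 (p * N)).subgroupOf (Gamma0 N) := by
  obtain ⟨c, hc⟩ := mem_Gamma0_iff_dvd.1 g.2
  obtain ⟨c', hc'⟩ := mem_Gamma0_iff_dvd.1 h.2
  have hN' : (N : ℤ) ≠ 0 := by exact_mod_cast hN.ne'
  have hg := Matrix.det_fin_two g.1.1
  have hh := Matrix.det_fin_two h.1.1
  rw [g.1.det_coe] at hg
  rw [h.1.det_coe] at hh
  have hentry : (g.1⁻¹ * h.1) 1 0 = N * (c' * g.1 0 0 - c * h.1 0 0) := by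
    rw [Matrix.SpecialLinearGroup.coe_mul, Matrix.mul_apply, Fin.sum_univ_two,
      Matrix.SpecialLinearGroup.SL2_inv_expl]
    simp [hc, hc']
    ring
  have hmem : g⁻¹ * h ∈ (Gamma0 (p * N)).subgroupOf (Gamma0 N) ↔
      (c' : ZMod p) * (g.1 0 0 : ℤ) = c * (h.1 0 0 : ℤ) := by
    rw [Subgroup.mem_subgroupOf, mem_Gamma0_iff_dvd]
    change _ ∣ (g.1⁻¹ * h.1) 1 0 ↔ _
    rw [hentry, Nat.cast_mul, mul_comm (p : ℤ), mul_dvd_mul_iff_left hN',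
      ← ZMod.intCast_zmod_eq_zero_iff_dvd]
    push_cast
    exact sub_eq_zero
  rw [hmem, columnRatio, columnRatio, hc, hc', Int.mul_ediv_cancel_left _ hN',
    Int.mul_ediv_cancel_left _ hN']
  have hg' : (1 : ZMod p) = (g.1 0 0 : ℤ) * (g.1 1 1 : ℤ) - (g.1 0 1 : ℤ) * (N * c) := by
    have := congrArg (Int.cast : ℤ → ZMod p) hg
    rw [hc] at this
    exact_mod_cast this
  have hh' : (1 : ZMod p) = (h.1 0 0 : ℤ) * (h.1 1 1 : ℤ) - (h.1 0 1 : ℤ) * (N * c') := by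
    have := congrArg (Int.cast : ℤ → ZMod p) hh
    rw [hc'] at this
    exact_mod_cast this
  by_cases ha : ((g.1 0 0 : ℤ) : ZMod p) = 0 <;> by_cases ha' : ((h.1 0 0 : ℤ) : ZMod p) = 0
  · simp [ha, ha']
  · simp only [ha, ha', if_true, if_false, mul_zero, reduceCtorEq, false_iff]
    intro H
    rcases mul_eq_zero.1 H.symm with H | H
    · simp [ha, H] at hg'
    · exact ha' H
  · simp only [ha, ha', if_true, if_false, mul_zero, reduceCtorEq, false_iff]
    intro H
    rcases mul_eq_zero.1 H with H | H
    · simp [ha', H] at hh'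
    · exact ha H
  · simp only [ha, ha', if_false, Option.some.injEq]
    rw [div_eq_div_iff ha ha', eq_comm]

theorem some_mem_range_columnRatio {N p : ℕ} [Fact p.Prime] (hN : 0 < N) (x : ZMod p) :
    some x ∈ Set.range (columnRatio N p) := by
  obtain ⟨k, rfl⟩ := ZMod.intCast_surjective x
  have hN' : (N : ℤ) ≠ 0 := by exact_mod_cast hN.ne'
  refine ⟨⟨⟨!![1, 0; N * k, 1], by simp [Matrix.det_fin_two]⟩, ?_⟩, ?_⟩
  · exact mem_Gamma0_iff_dvd.2 (dvd_mul_right _ _)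
  · simp [columnRatio, Int.mul_ediv_cancel_left k hN']

theorem none_mem_range_columnRatio_iff {N p : ℕ} [Fact p.Prime] :
    none ∈ Set.range (columnRatio N p) ↔ ¬ p ∣ N := by
  have hp : p.Prime := Fact.out
  constructor
  · rintro ⟨g, hg⟩ hpN
    have ha : ((g.1 0 0 : ℤ) : ZMod p) = 0 := by
      by_contra ha
      simp [columnRatio, ha] at hg
    have hdet := Matrix.det_fin_two g.1.1
    rw [g.1.det_coe] at hdet
    have hc : (p : ℤ) ∣ g.1 1 0 :=
      (Int.natCast_dvd_natCast.2 hpN).trans (mem_Gamma0_iff_dvd.1 g.2)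
    rw [ZMod.intCast_zmod_eq_zero_iff_dvd] at ha
    have h1 : (p : ℤ) ∣ 1 := hdet ▸ dvd_sub (ha.mul_right _) (hc.mul_left _)
    exact hp.one_lt.ne' (by exact_mod_cast Int.eq_one_of_dvd_one (by positivity) h1)
  · intro hpN
    obtain ⟨u, v, huv⟩ := Nat.isCoprime_iff_coprime.2 ((hp.coprime_iff_not_dvd).2 hpN)
    refine ⟨⟨⟨!![(p : ℤ), -v; N, u], ?_⟩, ?_⟩, ?_⟩
    · rw [Matrix.det_fin_two_of]
      linarith
    · exact mem_Gamma0_iff_dvd.2 dvd_rfl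
    · simp [columnRatio]

theorem ncard_range_columnRatio {N p : ℕ} [Fact p.Prime] (hN : 0 < N) :
    (Set.range (columnRatio N p)).ncard = if p ∣ N then p else p + 1 := by
  split_ifs with h
  · have : Set.range (columnRatio N p) = Set.range some := by
      ext (_ | x)
      · simpa [h] using none_mem_range_columnRatio_iff (N := N) (p := p)
      · simpa using some_mem_range_columnRatio hN x
    rw [this, ← Nat.card_coe_set_eq, Nat.card_range_of_injective (Option.some_injective _),
      Nat.card_zmod]
  · have : Set.range (columnRatio N p) = Set.univ := by
      rw [Set.eq_univ_iff_forall]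
      rintro (_ | x)
      · exact none_mem_range_columnRatio_iff.2 h
      · exact some_mem_range_columnRatio hN x
    rw [this, Set.ncard_univ, Finite.card_option, Nat.card_zmod]

theorem index_Gamma0_prime_mul {N p : ℕ} (hp : p.Prime) (hN : 0 < N) :
    (Gamma0 (p * N)).index = (if p ∣ N then p else p + 1) * (Gamma0 N).index := by
  have : Fact p.Prime := ⟨hp⟩
  have hle : Gamma0 (p * N) ≤ Gamma0 N := fun g hg => by
    rw [mem_Gamma0_iff_dvd] at hg ⊢
    exact (Int.natCast_dvd_natCast.2 (dvd_mul_left N p)).trans hg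
  rw [← Subgroup.relIndex_mul_index hle, Subgroup.relIndex,
    Subgroup.index_eq_ncard_range _ _ (columnRatio_eq_iff hN), ncard_range_columnRatio hN]

theorem index_Gamma0_eq_mul_prod (N : ℕ) (hN : 0 < N) :
    ((Gamma0 N).index : ℚ) = N * ∏ p ∈ N.primeFactors, (1 + 1 / (p : ℚ)) := by
  induction N using induction_on_primes with
  | zero => exact absurd hN (lt_irrefl 0)
  | one =>
    have : Gamma0 1 = ⊤ := eq_top_iff.2 fun g _ => mem_Gamma0_iff_dvd.2 (by simp)
    simp [this]
  | prime_mul p N hp ih =>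
    have hN' : 0 < N := Nat.pos_of_mul_pos_left hN
    have hp0 : (p : ℚ) ≠ 0 := by exact_mod_cast hp.ne_zero
    rw [index_Gamma0_prime_mul hp hN', Nat.cast_mul, ih hN',
      Nat.primeFactors_mul hp.ne_zero hN'.ne', hp.primeFactors]
    split_ifs with h
    · have hmem : p ∈ N.primeFactors := Nat.mem_primeFactors.2 ⟨hp, h, hN'.ne'⟩
      rw [Finset.union_eq_right.2 (Finset.singleton_subset_iff.2 hmem)]
      push_cast
      ring
    · rw [Finset.prod_union (by simp [h]), Finset.prod_singleton]
      push_cast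
      field_simp

end CongruenceSubgroup

namespace Nat

/-- The function `t ↦ (N / gcd(t², N)) φ(gcd(t, N / t))` on the divisors of `N`. -/
def cuspWidthSummand (N t : ℕ) : ℕ := N / gcd (t ^ 2) N * totient (gcd t (N / t))

theorem Coprime.gcd_mul_mul {a b m n : ℕ} (hmn : m.Coprime n) (han : a.Coprime n)
    (hbm : b.Coprime m) : gcd (a * b) (m * n) = gcd a m * gcd b n := by
  rw [hmn.gcd_mul, hbm.gcd_mul_right_cancel, han.gcd_mul_left_cancel]

theorem cuspWidthSummand_mul {m n a b : ℕ} (hmn : m.Coprime n) (ha : a ∣ m) (hb : b ∣ n) :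
    cuspWidthSummand (m * n) (a * b) = cuspWidthSummand m a * cuspWidthSummand n b := by
  have han : a.Coprime n := hmn.coprime_dvd_left ha
  have hbm : b.Coprime m := (hmn.coprime_dvd_right hb).symm
  have hma := div_dvd_of_dvd ha
  have hnb := div_dvd_of_dvd hb
  unfold cuspWidthSummand
  rw [mul_pow, hmn.gcd_mul_mul (han.pow_left 2) (hbm.pow_left 2),
    Nat.mul_div_mul_comm (gcd_dvd_right _ _) (gcd_dvd_right _ _),
    Nat.mul_div_mul_comm ha hb,
    Coprime.gcd_mul_mul ((hmn.coprime_dvd_left hma).coprime_dvd_right hnb)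
      (han.coprime_dvd_right hnb) (hbm.coprime_dvd_right hma),
    totient_mul]
  · ring
  · exact (han.coprime_dvd_left (gcd_dvd_left _ _)).coprime_dvd_right
      ((gcd_dvd_left _ _).trans hb)

theorem Coprime.sum_cuspWidthSummand_mul {m n : ℕ} (hmn : m.Coprime n) :
    ∑ t ∈ (m * n).divisors, cuspWidthSummand (m * n) t =
      (∑ t ∈ m.divisors, cuspWidthSummand m t) * ∑ t ∈ n.divisors, cuspWidthSummand n t := by
  rw [Nat.divisors_mul, Finset.mul_def, Finset.sum_image hmn.mul_injOn_divisors, Finset.sum_product,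
    Finset.sum_mul_sum]
  exact Finset.sum_congr rfl fun a ha => Finset.sum_congr rfl fun b hb =>
    cuspWidthSummand_mul hmn (dvd_of_mem_divisors ha) (dvd_of_mem_divisors hb)

theorem cuspWidthSummand_prime_pow {p : ℕ} (hp : p.Prime) (i j : ℕ) :
    cuspWidthSummand (p ^ (i + 1 + j)) (p ^ (i + 1)) = totient (p ^ j) := by
  have hdiv : p ^ (i + 1 + j) / p ^ (i + 1) = p ^ j := by
    rw [Nat.pow_div (by lia) hp.pos, Nat.add_sub_cancel_left]
  rw [cuspWidthSummand, hdiv, ← pow_mul]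
  rcases le_total j (i + 1) with h | h
  · rw [Nat.gcd_eq_right (pow_dvd_pow p (by lia)), Nat.gcd_eq_right (pow_dvd_pow p h),
      Nat.div_self (pow_pos hp.pos _), one_mul]
  · obtain ⟨k, rfl⟩ := Nat.exists_eq_add_of_le h
    rw [Nat.gcd_eq_left (pow_dvd_pow p (by lia)), Nat.gcd_eq_left (pow_dvd_pow p h),
      Nat.pow_div (by lia) hp.pos, totient_prime_pow_succ hp,
      show i + 1 + k = i + k + 1 by ring, totient_prime_pow_succ hp, ← mul_assoc, ← pow_add]
    congr 2
    lia

theorem sum_cuspWidthSummand_prime_pow_succ {p : ℕ} (hp : p.Prime) (m : ℕ) :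
    ∑ t ∈ (p ^ (m + 1)).divisors, cuspWidthSummand (p ^ (m + 1)) t = p ^ (m + 1) + p ^ m := by
  rw [sum_divisors_prime_pow hp, Finset.sum_range_succ', add_comm]
  congr 1
  · simp [cuspWidthSummand]
  · rw [← sum_totient (p ^ m), sum_divisors_prime_pow hp,
      ← Finset.sum_range_reflect (fun j => totient (p ^ j))]
    refine Finset.sum_congr rfl fun i hi => ?_
    have hi' : i ≤ m := Finset.mem_range_succ_iff.1 hi
    rw [← cuspWidthSummand_prime_pow hp i, show i + 1 + (m + 1 - 1 - i) = m + 1 by lia]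

theorem sum_cuspWidthSummand_eq_mul_prod (N : ℕ) (hN : 0 < N) :
    ((∑ t ∈ N.divisors, cuspWidthSummand N t : ℕ) : ℚ) =
      N * ∏ p ∈ N.primeFactors, (1 + 1 / (p : ℚ)) := by
  induction N using Nat.recOnPosPrimePosCoprime with
  | zero => exact absurd hN (lt_irrefl 0)
  | one => simp [cuspWidthSummand]
  | prime_pow p k hp hk =>
    obtain ⟨m, rfl⟩ := Nat.exists_eq_add_of_lt hk
    have hp0 : (p : ℚ) ≠ 0 := by exact_mod_cast hp.ne_zero
    rw [zero_add, sum_cuspWidthSummand_prime_pow_succ hp, primeFactors_prime_pow (by simp) hp,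
      Finset.prod_singleton]
    push_cast
    field_simp
    ring
  | coprime m n hm hn hmn ihm ihn =>
    rw [hmn.sum_cuspWidthSummand_mul, Nat.cast_mul, ihm (by lia), ihn (by lia),
      hmn.primeFactors_mul, Finset.prod_union hmn.disjoint_primeFactors]
    push_cast
    ring

end Nat

/-- `Σ_{t|N} (N/gcd(t²,N))·φ(gcd(t,N/t)) = [SL₂(ℤ):Γ₀(N)] = N·∏_{p|N}(1+1/p)`. -/
theorem stmt3 (N : ℕ) (hN : 0 < N) :
    (∑ t ∈ N.divisors, (N / Nat.gcd (t ^ 2) N) * Nat.totient (Nat.gcd t (N / t)))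
        = (CongruenceSubgroup.Gamma0 N).index ∧
    (((CongruenceSubgroup.Gamma0 N).index : ℚ)
        = (N : ℚ) * ∏ p ∈ N.primeFactors, (1 + 1 / (p : ℚ))) := by
  have hsum := Nat.sum_cuspWidthSummand_eq_mul_prod N hN
  have hindex := CongruenceSubgroup.index_Gamma0_eq_mul_prod N hN
  exact ⟨Nat.cast_injective (R := ℚ) (hsum.trans hindex.symm), hindex⟩
end

section
/- Let N be a positive integer, τ an element of the complex upper half-plane, and a, b integers with 0 < a ≤ N/2, 0 < b ≤ N/2 and a ≠ b. Then ℘(a/N; L_τ) ≠ ℘(b/N; L_τ). Consequently, for every 𝔞 ∈ 𝔈 and every τ in the upper half-plane, the value W_𝔞(τ) is a well-defined nonzero complex number (W_𝔞 has neither zeros nor poles on the upper half-plane). -/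
open scoped MatrixGroups
open Complex

open Filter Topology Bornology

/-- An analytic function whose second derivative is an analytic multiple of it, and which vanishes
to second order at a point, vanishes in a neighbourhood of this point. -/
theorem eventually_eq_zero_of_deriv_deriv_eq_mul {h s : ℂ → ℂ} {x : ℂ} (hh : AnalyticAt ℂ h x)
    (hs : AnalyticAt ℂ s x) (h0 : h x = 0) (h1 : deriv h x = 0)
    (h2 : deriv (deriv h) =ᶠ[𝓝 x] h * s) : ∀ᶠ z in 𝓝 x, h z = 0 := by
  rw [← analyticOrderAt_eq_top]
  have e1 := hh.analyticOrderAt_deriv_add_one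
  have e2 := hh.deriv.analyticOrderAt_deriv_add_one
  simp only [h0, h1, sub_zero] at e1 e2
  rw [analyticOrderAt_congr h2, analyticOrderAt_mul hh hs] at e2
  by_contra htop
  have hle : analyticOrderAt h x + 2 ≤ analyticOrderAt h x := by
    calc analyticOrderAt h x + 2
        ≤ analyticOrderAt h x + analyticOrderAt s x + 1 + 1 := by
          rw [add_assoc _ 1 1, one_add_one_eq_two]
          gcongr
          exact le_self_add
      _ = analyticOrderAt h x := by
          rw [e2]
          exact e1
  lift analyticOrderAt h x to ℕ using htop with n
  norm_cast at hle
  omega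

namespace PeriodPair

variable (L : PeriodPair)

theorem countable_lattice : (L.lattice : Set ℂ).Countable := by
  rw [← Set.countable_coe_iff]
  exact L.latticeEquivProd.injective.countable

theorem isPreconnected_compl_of_countable {s : Set ℂ} (hs : s.Countable) :
    IsPreconnected sᶜ :=
  (hs.isConnected_compl_of_one_lt_rank (by simp)).isPreconnected

theorem tendsto_weierstrassP_cobounded {l : ℂ} (hl : l ∈ L.lattice) :
    Tendsto L.weierstrassP (𝓝[≠] l) (cobounded ℂ) :=
  tendsto_cobounded_of_meromorphicOrderAt_neg (by rw [L.order_weierstrassP l hl]; decide)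

theorem eventually_notMem_lattice_nhdsNE (x : ℂ) : ∀ᶠ z in 𝓝[≠] x, z ∉ L.lattice := by
  filter_upwards [self_mem_nhdsWithin, mem_nhdsWithin_of_mem_nhds
    (L.compl_lattice_sdiff_singleton_mem_nhds x)] with z hz hz'
  simp_all

theorem eventually_notMem_lattice {x : ℂ} (hx : x ∉ L.lattice) :
    ∀ᶠ z in 𝓝 x, z ∉ L.lattice :=
  L.isClosed_lattice.isOpen_compl.mem_nhds hx

theorem hasDerivAt_weierstrassP {z : ℂ} (hz : z ∉ L.lattice) :
    HasDerivAt L.weierstrassP (L.derivWeierstrassP z) z := by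
  rw [← L.deriv_weierstrassP]
  exact (L.analyticOnNhd_weierstrassP z hz).differentiableAt.hasDerivAt

theorem exists_derivWeierstrassP_ne_zero : ∃ z ∉ L.lattice, L.derivWeierstrassP z ≠ 0 := by
  by_contra! hall
  obtain ⟨c, hc⟩ := L.isClosed_lattice.isOpen_compl.exists_is_const_of_deriv_eq_zero
    (isPreconnected_compl_of_countable L.countable_lattice) L.differentiableOn_weierstrassP
    (fun z hz ↦ by simpa using hall z hz)
  have hlim : Tendsto L.weierstrassP (𝓝[≠] 0) (𝓝 c) :=
    tendsto_const_nhds.congr' <| (L.eventually_notMem_lattice_nhdsNE 0).mono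
      fun z hz ↦ (hc z hz).symm
  exact hlim.not_tendsto (Metric.disjoint_nhds_cobounded c)
    (L.tendsto_weierstrassP_cobounded L.lattice.zero_mem)

/-- The second-order differential equation of `℘`. -/
theorem deriv_derivWeierstrassP {z : ℂ} (hz : z ∉ L.lattice) :
    deriv L.derivWeierstrassP z = 6 * L.weierstrassP z ^ 2 - L.g₂ / 2 := by
  have hP := L.analyticOnNhd_weierstrassP
  have hP' := L.analyticOnNhd_derivWeierstrassP
  have hprod : ∀ w ∈ (L.lattice : Set ℂ)ᶜ, L.derivWeierstrassP w *
      (deriv L.derivWeierstrassP w - (6 * L.weierstrassP w ^ 2 - L.g₂ / 2)) = 0 := by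
    intro w hw
    have hd : HasDerivAt L.derivWeierstrassP (deriv L.derivWeierstrassP w) w :=
      (hP' w hw).differentiableAt.hasDerivAt
    have hp := L.hasDerivAt_weierstrassP hw
    have hr := (((hp.fun_pow 3).const_mul 4).fun_sub (hp.const_mul L.g₂)).sub_const L.g₃
    have heq := (hd.fun_pow 2).unique <| hr.congr_of_eventuallyEq <|
      (L.eventually_notMem_lattice hw).mono fun y hy ↦ L.derivWeierstrassP_sq y hy
    push_cast at heq
    linear_combination heq / 2
  have han : AnalyticOnNhd ℂ (fun w ↦ deriv L.derivWeierstrassP w -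
      (6 * L.weierstrassP w ^ 2 - L.g₂ / 2)) (L.lattice : Set ℂ)ᶜ := fun w hw ↦ by
    have := hP w hw
    have := (hP' w hw).deriv
    fun_prop
  rcases AnalyticOnNhd.eq_zero_or_eq_zero_of_mul_eq_zero hP' han hprod
    (isPreconnected_compl_of_countable L.countable_lattice) with h | h
  · obtain ⟨w, hw, hw'⟩ := L.exists_derivWeierstrassP_ne_zero
    exact absurd (h w hw) hw'
  · exact sub_eq_zero.mp (h z hz)

theorem sub_mem_lattice_of_eventuallyEq {u d : ℂ} (hu : u ∉ L.lattice) (hd : u + d ∉ L.lattice)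
    (h : ∀ᶠ z in 𝓝 u, L.weierstrassP z = L.weierstrassP (z + d)) : d ∈ L.lattice := by
  by_contra hdL
  let s : Set ℂ := L.lattice ∪ (· + d) ⁻¹' L.lattice
  have hs : s.Countable :=
    L.countable_lattice.union (L.countable_lattice.preimage (add_left_injective d))
  have hsmem {z : ℂ} : z ∈ sᶜ ↔ z ∉ L.lattice ∧ z + d ∉ L.lattice := by
    simp [s]
  have han : AnalyticOnNhd ℂ (fun z ↦ L.weierstrassP (z + d)) sᶜ := fun z hz ↦
    AnalyticAt.fun_comp (f := (· + d)) (L.analyticOnNhd_weierstrassP (z + d) (hsmem.mp hz).2)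
      (by fun_prop)
  have heq := AnalyticOnNhd.eqOn_of_preconnected_of_eventuallyEq
    (fun z hz ↦ L.analyticOnNhd_weierstrassP z (hsmem.mp hz).1) han
    (isPreconnected_compl_of_countable hs) (hsmem.mpr ⟨hu, hd⟩) h
  have hcont : Tendsto (fun z ↦ z + d) (𝓝 0) (𝓝 d) := by
    simpa using (continuous_add_const d).tendsto 0
  have hlim : Tendsto (fun z ↦ L.weierstrassP (z + d)) (𝓝[≠] 0) (𝓝 (L.weierstrassP d)) :=
    ((L.analyticOnNhd_weierstrassP d hdL).continuousAt.tendsto.comp hcont).mono_left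
      nhdsWithin_le_nhds
  refine (hlim.congr' ?_).not_tendsto (Metric.disjoint_nhds_cobounded _)
    (L.tendsto_weierstrassP_cobounded L.lattice.zero_mem)
  filter_upwards [L.eventually_notMem_lattice_nhdsNE 0,
    (hcont.eventually (L.eventually_notMem_lattice hdL)).filter_mono nhdsWithin_le_nhds]
    with z hz hz'
  exact (heq (hsmem.mpr ⟨hz, hz'⟩)).symm

theorem sub_mem_lattice_of_weierstrassP_eq_of_derivWeierstrassP_eq {u v : ℂ}
    (hu : u ∉ L.lattice) (hv : v ∉ L.lattice) (h : L.weierstrassP u = L.weierstrassP v)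
    (h' : L.derivWeierstrassP u = L.derivWeierstrassP v) : v - u ∈ L.lattice := by
  have huv : u + (v - u) = v := by ring
  refine L.sub_mem_lattice_of_eventuallyEq hu (by rwa [huv]) ?_
  have hcont : Tendsto (fun z ↦ z + (v - u)) (𝓝 u) (𝓝 v) := by
    simpa using (continuous_add_const (v - u)).tendsto u
  have hPu := L.analyticOnNhd_weierstrassP u hu
  have hPv : AnalyticAt ℂ (fun z ↦ L.weierstrassP (z + (v - u))) u :=
    AnalyticAt.fun_comp (by rw [huv]; exact L.analyticOnNhd_weierstrassP v hv) (by fun_prop)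
  have hnear : ∀ᶠ z in 𝓝 u, z ∉ L.lattice ∧ z + (v - u) ∉ L.lattice :=
    (L.eventually_notMem_lattice hu).and (hcont.eventually (L.eventually_notMem_lattice hv))
  have hd1 : deriv (fun z ↦ L.weierstrassP z - L.weierstrassP (z + (v - u))) =ᶠ[𝓝 u]
      fun z ↦ L.derivWeierstrassP z - L.derivWeierstrassP (z + (v - u)) :=
    hnear.mono fun z hz ↦ ((L.hasDerivAt_weierstrassP hz.1).fun_sub
      ((L.hasDerivAt_weierstrassP hz.2).comp_add_const z (v - u))).deriv
  have hzero := eventually_eq_zero_of_deriv_deriv_eq_mul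
    (h := fun z ↦ L.weierstrassP z - L.weierstrassP (z + (v - u)))
    (s := fun z ↦ 6 * (L.weierstrassP z + L.weierstrassP (z + (v - u))))
    (hPu.fun_sub hPv) (by fun_prop) (by simp [h]) (by simp [hd1.eq_of_nhds, h']) ?_
  · exact hzero.mono fun z hz ↦ sub_eq_zero.mp hz
  · refine hd1.deriv.trans (hnear.mono fun z hz ↦ ?_)
    have hd (w : ℂ) (hw : w ∉ L.lattice) : HasDerivAt L.derivWeierstrassP
        (6 * L.weierstrassP w ^ 2 - L.g₂ / 2) w := by
      rw [← L.deriv_derivWeierstrassP hw]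
      exact (L.analyticOnNhd_derivWeierstrassP w hw).differentiableAt.hasDerivAt
    rw [((hd _ hz.1).fun_sub ((hd _ hz.2).comp_add_const z (v - u))).deriv, Pi.mul_apply]
    ring

/-- The fibres of `℘` are the orbits of `±1` on `ℂ / L`. -/
theorem sub_mem_lattice_or_add_mem_lattice_of_weierstrassP_eq {u v : ℂ}
    (hu : u ∉ L.lattice) (hv : v ∉ L.lattice) (h : L.weierstrassP u = L.weierstrassP v) :
    v - u ∈ L.lattice ∨ v + u ∈ L.lattice := by
  have hsq : L.derivWeierstrassP u ^ 2 = L.derivWeierstrassP v ^ 2 := by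
    rw [L.derivWeierstrassP_sq u hu, L.derivWeierstrassP_sq v hv, h]
  rcases sq_eq_sq_iff_eq_or_eq_neg.mp hsq with h' | h'
  · exact .inl (L.sub_mem_lattice_of_weierstrassP_eq_of_derivWeierstrassP_eq hu hv h h')
  · right
    have := L.sub_mem_lattice_of_weierstrassP_eq_of_derivWeierstrassP_eq (u := -u)
      (by simpa using hu) hv (by simpa using h) (by simp [h'])
    simpa using this

/-- The pair of periods `1, τ`, for `τ` in the upper half-plane. -/
noncomputable def ofIm {τ : ℂ} (hτ : 0 < τ.im) : PeriodPair where
  ω₁ := 1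
  ω₂ := τ
  indep := by
    rw [LinearIndependent.pair_iff]
    intro s t hst
    have him := congrArg Complex.im hst
    have hre := congrArg Complex.re hst
    have ht : t = 0 := by simpa [hτ.ne'] using him
    exact ⟨by simpa [ht] using hre, ht⟩

theorem mem_lattice_ofIm {τ : ℂ} (hτ : 0 < τ.im) {z : ℂ} :
    z ∈ (ofIm hτ).lattice ↔ ∃ m n : ℤ, (m : ℂ) + n * τ = z := by
  simp [mem_lattice, ofIm]

theorem wp_eq_weierstrassP {τ : ℂ} (hτ : 0 < τ.im) (z : ℂ) :
    wp τ z = (ofIm hτ).weierstrassP z := by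
  have hmem (p : ℤ × ℤ) :
      ((ofIm hτ).latticeEquivProd.symm p : ℂ) = (p.1 : ℂ) + (p.2 : ℂ) * τ := by
    rw [latticeEquiv_symm_apply]
    simp [ofIm]
  rw [← (ofIm hτ).weierstrassPExcept_add 0, weierstrassPExcept,
    ← (ofIm hτ).latticeEquivProd.symm.toEquiv.tsum_eq, wp, add_comm]
  congr 1
  · refine (tsum_subtype {p : ℤ × ℤ | p ≠ 0} fun p ↦
      1 / (z - ((p.1 : ℂ) + (p.2 : ℂ) * τ)) ^ 2 - 1 / ((p.1 : ℂ) + (p.2 : ℂ) * τ) ^ 2).trans ?_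
    refine tsum_congr fun p ↦ ?_
    by_cases hp : p = 0
    · simp [hp]
    · have hne : (p.1 : ℂ) + (p.2 : ℂ) * τ ≠ 0 := by simpa [← hmem] using hp
      simp [hp, hmem, hne]
  · simp

theorem intCast_div_mem_lattice_ofIm {τ : ℂ} (hτ : 0 < τ.im) {N : ℕ} (hN : 0 < N) {a : ℤ}
    (h : (a : ℂ) / N ∈ (ofIm hτ).lattice) : (N : ℤ) ∣ a := by
  obtain ⟨m, n, hmn⟩ := (mem_lattice_ofIm hτ).mp h
  have hN' : (N : ℂ) ≠ 0 := by exact_mod_cast hN.ne'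
  have hmul : (m : ℂ) * N + n * N * τ = a := by
    rw [eq_div_iff hN'] at hmn
    linear_combination hmn
  have hn : n = 0 := by
    have him := congrArg Complex.im hmul
    simpa [hτ.ne', hN.ne'] using him
  refine ⟨m, ?_⟩
  rw [hn] at hmul
  have : m * N = a := by
    simp only [Int.cast_zero, zero_mul, add_zero] at hmul
    exact_mod_cast hmul
  rw [← this, mul_comm]

end PeriodPair

/-- The values of `℘` at the points `a / N` with `0 < a ≤ N / 2` are distinct. -/
theorem wp_intCast_div_ne {N : ℕ} (hN : 0 < N) {τ : ℂ} (hτ : 0 < τ.im) {a b : ℤ} (ha : 0 < a)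
    (ha' : 2 * a ≤ N) (hb : 0 < b) (hb' : 2 * b ≤ N) (hab : a ≠ b) :
    wp τ ((a : ℂ) / N) ≠ wp τ ((b : ℂ) / N) := by
  have hnot {c : ℤ} (hc : c ≠ 0) (hlt : |c| < N) :
      (c : ℂ) / N ∉ (PeriodPair.ofIm hτ).lattice := fun h ↦
    hc (Int.eq_zero_of_abs_lt_dvd (PeriodPair.intCast_div_mem_lattice_ofIm hτ hN h) hlt)
  intro h
  rw [PeriodPair.wp_eq_weierstrassP hτ, PeriodPair.wp_eq_weierstrassP hτ] at h
  rcases PeriodPair.sub_mem_lattice_or_add_mem_lattice_of_weierstrassP_eq _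
    (hnot ha.ne' (by grind)) (hnot hb.ne' (by grind)) h with h | h
  · exact hnot (c := b - a) (by omega) (by grind) (by simpa [sub_div] using h)
  · exact hnot (c := b + a) (by omega) (by grind) (by simpa [add_div] using h)

/-- `℘(a/N; L_τ) ≠ ℘(b/N; L_τ)` for distinct `a,b` with `0 < a,b ≤ N/2`;
consequently for every `𝔞 ∈ 𝔈` the value `W_𝔞(τ)` is well defined and nonzero. -/
theorem stmt4 (N : ℕ) (hN : 0 < N) (τ : ℂ) (hτ : 0 < τ.im) :
    (∀ a b : ℤ, 0 < a → 2 * a ≤ (N : ℤ) → 0 < b → 2 * b ≤ (N : ℤ) → a ≠ b →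
      wp τ ((a : ℂ) / N) ≠ wp τ ((b : ℂ) / N)) ∧
    (∀ a : ℤ × ℤ × ℤ, memE N a →
      (wp τ ((a.2.1 : ℂ) / N) - wp τ ((a.2.2 : ℂ) / N) ≠ 0 ∧
       Wfun N a.1 a.2.1 a.2.2 τ ≠ 0)) := by
  refine ⟨fun a b ha ha' hb hb' hab ↦ wp_intCast_div_ne hN hτ ha ha' hb hb' hab, ?_⟩
  rintro ⟨a₁, a₂, a₃⟩ ⟨h₁, h₂, h₃, h₁', h₂', h₃', -, h₁₃, h₂₃⟩
  have hnum := sub_ne_zero.mpr (wp_intCast_div_ne hN hτ h₁ h₁' h₃ h₃' h₁₃)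
  have hden := sub_ne_zero.mpr (wp_intCast_div_ne hN hτ h₂ h₂' h₃ h₃' h₂₃)
  exact ⟨hden, div_ne_zero hnum hden⟩
end

section
/- Let N be a positive integer and 𝔞 ∈ 𝔈. Then W_𝔞 is invariant under Γ₁(N): for every matrix A = (a b; c d) ∈ Γ₁(N) and every τ in the upper half-plane, W_𝔞((aτ+b)/(cτ+d)) = W_𝔞(τ). -/
open scoped MatrixGroups
open Complex

/-- The period pair `(1, τ)` of the lattice `L_τ`. -/
noncomputable def tauPair (τ : ℂ) (hτ : 0 < τ.im) : PeriodPair where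
  ω₁ := 1
  ω₂ := τ
  indep := by
    refine LinearIndependent.pair_iff.mpr fun s t h => ?_
    have ht : t = 0 := by simpa [hτ.ne'] using congrArg Complex.im h
    exact ⟨by simpa [ht] using congrArg Complex.re h, ht⟩

lemma mem_tauPair_lattice {τ : ℂ} (hτ : 0 < τ.im) {x : ℂ} :
    x ∈ (tauPair τ hτ).lattice ↔ ∃ m n : ℤ, (m : ℂ) + n * τ = x := by
  simp [PeriodPair.mem_lattice, tauPair]

lemma wp_eq_weierstrassP {τ : ℂ} (hτ : 0 < τ.im) (z : ℂ) :
    wp τ z = (tauPair τ hτ).weierstrassP z := by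
  let e := (tauPair τ hτ).latticeEquivProd.symm
  let f : ℤ × ℤ → ℂ := fun p =>
    1 / (z - ((p.1 : ℂ) + p.2 * τ)) ^ 2 - 1 / ((p.1 : ℂ) + p.2 * τ) ^ 2
  have hf : HasSum f ((tauPair τ hτ).weierstrassP z) := by
    convert! e.toEquiv.hasSum_iff.mpr ((tauPair τ hτ).hasSum_weierstrassP z) using 1
    ext p
    have he : ((e p : (tauPair τ hτ).lattice) : ℂ) = p.1 + p.2 * τ :=
      ((tauPair τ hτ).latticeEquiv_symm_apply p).trans (by simp [tauPair])
    simp [f, he]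
  have h := hf.summable.sum_add_tsum_subtype_compl {0}
  rw [hf.tsum_eq, Finset.sum_singleton, show f 0 = 1 / z ^ 2 by simp [f]] at h
  rw [← h, wp]
  congr 1
  exact (Equiv.subtypeEquivRight fun p : ℤ × ℤ => by simp).tsum_eq
    (fun p : {p : ℤ × ℤ // p ∉ ({0} : Finset (ℤ × ℤ))} => f p)

lemma PeriodPair.weierstrassP_of_lattice_smul (L M : PeriodPair) {u : ℂ} (hu : u ≠ 0)
    (h : ∀ x, x ∈ M.lattice ↔ u * x ∈ L.lattice) (z : ℂ) :
    M.weierstrassP z = u ^ 2 * L.weierstrassP (u * z) := by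
  let e : M.lattice ≃ L.lattice := (Equiv.mulLeft₀ u hu).subtypeEquiv h
  rw [PeriodPair.weierstrassP, PeriodPair.weierstrassP, ← e.tsum_eq, ← tsum_mul_left]
  congr with l
  have he : ((e l : L.lattice) : ℂ) = u * l := rfl
  rw [he, ← mul_sub, mul_pow, mul_pow, mul_sub, ← mul_div_assoc, ← mul_div_assoc,
    mul_div_mul_left _ _ (pow_ne_zero 2 hu), mul_div_mul_left _ _ (pow_ne_zero 2 hu)]

lemma denom_ne_zero_of_det_eq_one {a b c d : ℤ} (hdet : a * d - b * c = 1) {τ : ℂ}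
    (hτ : 0 < τ.im) : (c : ℂ) * τ + d ≠ 0 := by
  intro h
  have hc : c = 0 := by simpa [hτ.ne'] using congrArg Complex.im h
  have hd : d = 0 := by simpa [hc] using congrArg Complex.re h
  simp [hc, hd] at hdet

lemma im_moebius_pos {a b c d : ℤ} (hdet : a * d - b * c = 1) {τ : ℂ} (hτ : 0 < τ.im) :
    0 < (((a : ℂ) * τ + b) / ((c : ℂ) * τ + d)).im := by
  have hu := Complex.normSq_pos.mpr (denom_ne_zero_of_det_eq_one hdet hτ)
  have hdet' : (a : ℝ) * d - b * c = 1 := by exact_mod_cast hdet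
  rw [Complex.div_im, ← sub_div]
  refine div_pos (hτ.trans_eq ?_) hu
  simp
  linear_combination -hdet' * τ.im

/-- The weight-two transformation law of `℘` under `SL₂(ℤ)`. -/
lemma wp_moebius {a b c d : ℤ} (hdet : a * d - b * c = 1) {τ : ℂ} (hτ : 0 < τ.im) (z : ℂ) :
    wp (((a : ℂ) * τ + b) / ((c : ℂ) * τ + d)) z
      = ((c : ℂ) * τ + d) ^ 2 * wp τ (((c : ℂ) * τ + d) * z) := by
  have hu := denom_ne_zero_of_det_eq_one hdet hτ
  have hdet' : (a : ℂ) * d - b * c = 1 := by exact_mod_cast hdet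
  rw [wp_eq_weierstrassP (im_moebius_pos hdet hτ), wp_eq_weierstrassP hτ]
  refine PeriodPair.weierstrassP_of_lattice_smul _ _ hu (fun x => ?_) z
  rw [mem_tauPair_lattice, mem_tauPair_lattice]
  constructor
  · rintro ⟨m, n, rfl⟩
    refine ⟨m * d + n * b, m * c + n * a, ?_⟩
    push_cast
    field_simp
    ring
  · rintro ⟨m, n, h⟩
    refine ⟨m * a - n * b, n * d - m * c, mul_left_cancel₀ hu (h ▸ ?_)⟩
    push_cast
    field_simp
    linear_combination ((m : ℂ) + n * τ) * hdet'

lemma wp_add_lattice {τ : ℂ} (hτ : 0 < τ.im) (z : ℂ) (m n : ℤ) :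
    wp τ (z + (m + n * τ)) = wp τ z := by
  rw [wp_eq_weierstrassP hτ, wp_eq_weierstrassP hτ]
  exact (tauPair τ hτ).weierstrassP_add_coe z ⟨_, (mem_tauPair_lattice hτ).mpr ⟨m, n, rfl⟩⟩

lemma wp_moebius_div_of_Gamma1 {N : ℕ} (hN : 0 < N) {A : SL(2, ℤ)}
    (hA : A ∈ CongruenceSubgroup.Gamma1 N) {τ : ℂ} (hτ : 0 < τ.im) (s : ℤ) :
    wp (((A 0 0 : ℂ) * τ + (A 0 1 : ℂ)) / ((A 1 0 : ℂ) * τ + (A 1 1 : ℂ))) ((s : ℂ) / N)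
      = ((A 1 0 : ℂ) * τ + (A 1 1 : ℂ)) ^ 2 * wp τ ((s : ℂ) / N) := by
  have hdet : A 0 0 * A 1 1 - A 0 1 * A 1 0 = 1 := by
    rw [← Matrix.det_fin_two]
    exact A.det_coe
  have hN' : (N : ℂ) ≠ 0 := by exact_mod_cast hN.ne'
  obtain ⟨-, hd, hc⟩ := (CongruenceSubgroup.Gamma1_mem N A).mp hA
  obtain ⟨k, hk⟩ := (ZMod.intCast_zmod_eq_zero_iff_dvd _ N).mp hc
  obtain ⟨l, hl⟩ : (N : ℤ) ∣ A 1 1 - 1 := by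
    rw [← ZMod.intCast_zmod_eq_zero_iff_dvd]
    simp [hd]
  have hk' : (A 1 0 : ℂ) = N * k := by exact_mod_cast hk
  have hl' : (A 1 1 : ℂ) = N * l + 1 := by exact_mod_cast sub_eq_iff_eq_add.mp hl
  rw [wp_moebius hdet hτ, ← wp_add_lattice hτ ((s : ℂ) / N) (l * s) (k * s)]
  congr 2
  rw [hk', hl']
  push_cast
  field_simp
  ring

/-- `W_𝔞` is invariant under `Γ₁(N)`. -/
theorem stmt5 (N : ℕ) (hN : 0 < N) (a : ℤ × ℤ × ℤ) (ha : memE N a)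
    (A : SL(2, ℤ)) (hA : A ∈ CongruenceSubgroup.Gamma1 N) (τ : ℂ) (hτ : 0 < τ.im) :
    Wfun N a.1 a.2.1 a.2.2
        (((A 0 0 : ℂ) * τ + (A 0 1 : ℂ)) / ((A 1 0 : ℂ) * τ + (A 1 1 : ℂ)))
      = Wfun N a.1 a.2.1 a.2.2 τ := by
  have hdet : A 0 0 * A 1 1 - A 0 1 * A 1 0 = 1 := by
    rw [← Matrix.det_fin_two]
    exact A.det_coe
  have hu := denom_ne_zero_of_det_eq_one hdet hτ
  simp only [Wfun, wp_moebius_div_of_Gamma1 hN hA hτ]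
  rw [← mul_sub, ← mul_sub, mul_div_mul_left _ _ (pow_ne_zero 2 hu)]
end
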